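/- Every element g of the positive braid monoid B_n^+ admits a unique decomposition s_1|…|s_p where each s_i is a left-divisor of Δ_n, s_p ≠ 1, and, for every i < p and every left-divisor s of Δ_n, if s_i ≺ s then s does not left-divide the product s_i s_{i+1} ⋯ s_p. -/

import Mathlib

/-- The braid relations on the free monoid over `Fin m` (generator `i` stands for `σ_{i+1}`):
`σ_i σ_j = σ_j σ_i` for `|i − j| ≥ 2` and `σ_i σ_j σ_i = σ_j σ_i σ_j` for `|i − j| = 1`. -/
def BraidRel (m : ℕ) : FreeMonoid (Fin m) → FreeMonoid (Fin m) → Prop := fun u v =>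
  (∃ i j : Fin m, (i : ℕ) + 2 ≤ (j : ℕ) ∧
    u = FreeMonoid.of i * FreeMonoid.of j ∧ v = FreeMonoid.of j * FreeMonoid.of i) ∨
  (∃ i j : Fin m, (i : ℕ) + 1 = (j : ℕ) ∧
    u = FreeMonoid.of i * FreeMonoid.of j * FreeMonoid.of i ∧
    v = FreeMonoid.of j * FreeMonoid.of i * FreeMonoid.of j)

/-- The positive braid monoid `B_n^+`, presented by the generators `σ_1, …, σ_{n−1}`
and the braid relations. -/
abbrev PosBraid (n : ℕ) := (conGen (BraidRel (n - 1))).Quotient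

/-- The generator `σ_{j+1}` of `B_n^+` (0-based index `j`), with junk value `1` out of range. -/
def braidSigma (n : ℕ) (j : ℕ) : PosBraid n :=
  if h : j < n - 1 then (conGen (BraidRel (n - 1))).mk' (FreeMonoid.of (⟨j, h⟩ : Fin (n - 1)))
  else 1

/-- `braidDelta n k` is Garside's element `Δ_k` inside `B_n^+`:
`Δ_1 = 1` and `Δ_{k+1} = Δ_k · σ_k σ_{k−1} ⋯ σ_1`. -/
def braidDelta (n : ℕ) : ℕ → PosBraid n
  | 0 => 1
  | k + 1 => braidDelta n k * (((List.range k).reverse).map (braidSigma n)).prod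

/-- Left-divisibility: `f ≼ g` iff `f * c = g` for some `c`. -/
def LDvd {M : Type*} [Monoid M] (f g : M) : Prop := ∃ c, f * c = g

namespace PosBraid

/-- Generator indices that differ by exactly one. -/
def Adj {m : ℕ} (i j : Fin m) : Prop := (i : ℕ) + 1 = j ∨ (j : ℕ) + 1 = i

instance {m : ℕ} (i j : Fin m) : Decidable (Adj i j) := by unfold Adj; infer_instance

theorem Adj.symm {m : ℕ} {i j : Fin m} (h : Adj i j) : Adj j i := Or.symm h

/-- The braid monoid with `m` generators. -/
abbrev Mon (m : ℕ) := (conGen (BraidRel m)).Quotient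

variable {m : ℕ}

/-- The generators of the braid monoid. -/
def gen (i : Fin m) : Mon m := (conGen (BraidRel m)).mk' (FreeMonoid.of i)

theorem gen_comm {i j : Fin m} (h : ¬ Adj i j) : gen i * gen j = gen j * gen i := by
  have key : ∀ i j : Fin m, (i : ℕ) + 2 ≤ j → gen i * gen j = gen j * gen i := fun i j h =>
    (Con.eq _).2 (ConGen.Rel.of _ _ (Or.inl ⟨i, j, h, rfl, rfl⟩))
  rcases lt_trichotomy (i : ℕ) j with hl | he | hl
  · exact key i j (by unfold Adj at h; omega)
  · rw [Fin.ext he]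
  · exact (key j i (by unfold Adj at h; omega)).symm

theorem gen_braid {i j : Fin m} (h : Adj i j) :
    gen i * gen j * gen i = gen j * gen i * gen j := by
  have key : ∀ i j : Fin m, (i : ℕ) + 1 = j → gen i * gen j * gen i = gen j * gen i * gen j :=
    fun i j h => (Con.eq _).2 (ConGen.Rel.of _ _ (Or.inr ⟨i, j, h, rfl, rfl⟩))
  rcases h with h | h
  · exact key i j h
  · exact (key j i h).symm

theorem gen_comm_mul {i j : Fin m} (h : ¬ Adj i j) (x : Mon m) :
    gen i * (gen j * x) = gen j * (gen i * x) := by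
  rw [← mul_assoc, gen_comm h, mul_assoc]

theorem gen_braid_mul {i j : Fin m} (h : Adj i j) (x : Mon m) :
    gen i * (gen j * (gen i * x)) = gen j * (gen i * (gen j * x)) := by
  simpa only [mul_assoc] using congrArg (· * x) (gen_braid h)

/-- Word length as a homomorphism. -/
def lenHom (m : ℕ) : Mon m →* Multiplicative ℕ :=
  (conGen (BraidRel m)).lift (FreeMonoid.lift fun _ => Multiplicative.ofAdd 1) <| by
    rw [Con.conGen_le]
    rintro u v (⟨i, j, -, rfl, rfl⟩ | ⟨i, j, -, rfl, rfl⟩) <;> simp [Con.ker_rel]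

/-- The common length of the words representing an element. -/
def len (x : Mon m) : ℕ := (lenHom m x).toAdd

@[simp] theorem len_one : len (1 : Mon m) = 0 := by simp [len]

@[simp] theorem len_mul (x y : Mon m) : len (x * y) = len x + len y := by simp [len]

@[simp] theorem len_gen (i : Fin m) : len (gen i) = 1 := rfl

theorem mon_cases (x : Mon m) : x = 1 ∨ ∃ i y, x = gen i * y := by
  induction x using Con.induction_on with
  | H w =>
    cases w using FreeMonoid.casesOn with
    | one => exact Or.inl rfl
    | of_mul i w => exact Or.inr ⟨i, (w : Mon m), rfl⟩

theorem len_eq_zero {x : Mon m} : len x = 0 ↔ x = 1 := by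
  refine ⟨fun h => ?_, fun h => by simp [h]⟩
  rcases mon_cases x with rfl | ⟨i, y, rfl⟩
  · rfl
  · simp at h

/-- The complement of `gen i` in the least common right multiple of `gen i` and `gen j`. -/
def compl (i j : Fin m) : Mon m :=
  if i = j then 1 else if Adj i j then gen j * gen i else gen j

theorem compl_self (i : Fin m) : compl i i = 1 := by simp [compl]

theorem compl_adj {i j : Fin m} (h : Adj i j) : compl i j = gen j * gen i := by
  have : i ≠ j := by rintro rfl; unfold Adj at h; omega
  simp [compl, this, h]

theorem compl_not_adj {i j : Fin m} (hne : i ≠ j) (h : ¬ Adj i j) : compl i j = gen j := by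
  simp [compl, hne, h]

theorem gen_mul_compl (i j : Fin m) : gen i * compl i j = gen j * compl j i := by
  by_cases hne : i = j
  · rw [hne]
  by_cases h : Adj i j
  · rw [compl_adj h, compl_adj h.symm, ← mul_assoc, ← mul_assoc, gen_braid h]
  · rw [compl_not_adj hne h, compl_not_adj (Ne.symm hne) (mt Adj.symm h), gen_comm h]

/-- The pairs `(gen i, x)` and `(gen j, y)` are completed by a common right multiple
of `gen i` and `gen j`. -/
def Linked (i : Fin m) (x : Mon m) (j : Fin m) (y : Mon m) : Prop :=
  ∃ z, x = compl i j * z ∧ y = compl j i * z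

theorem Linked.refl (i : Fin m) (x : Mon m) : Linked i x i x :=
  ⟨x, by simp [compl_self], by simp [compl_self]⟩

theorem Linked.symm {i j : Fin m} {x y : Mon m} (h : Linked i x j y) : Linked j y i x :=
  let ⟨z, hx, hy⟩ := h
  ⟨z, hy, hx⟩

/-- The instances of the lcm property for equal elements of length at most `N`. -/
def LcmUpTo (m N : ℕ) : Prop :=
  ∀ (i j : Fin m) (x y : Mon m), len x < N → gen i * x = gen j * y → Linked i x j y

section Cube

variable {N : ℕ} {i j k : Fin m} {x y p q : Mon m}

theorem LcmUpTo.cancel (H : LcmUpTo m N) (hl : len x < N) (h : gen i * x = gen i * y) :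
    x = y := by
  obtain ⟨z, hx, hy⟩ := H i i x y hl h
  rw [hx, hy]

theorem LcmUpTo.not_adj (H : LcmUpTo m N) (hne : i ≠ j) (ha : ¬ Adj i j) (hl : len x < N)
    (h : gen i * x = gen j * y) : ∃ z, x = gen j * z ∧ y = gen i * z := by
  have := H i j x y hl h
  rwa [Linked, compl_not_adj hne ha, compl_not_adj hne.symm (mt Adj.symm ha)] at this

theorem LcmUpTo.adj (H : LcmUpTo m N) (ha : Adj i j) (hl : len x < N)
    (h : gen i * x = gen j * y) : ∃ z, x = gen j * (gen i * z) ∧ y = gen i * (gen j * z) := by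
  simpa only [Linked, compl_adj ha, compl_adj ha.symm, mul_assoc] using H i j x y hl h

theorem linked_of_chain_left (H : LcmUpTo m N) (hkj : k ≠ j) (aki : Adj k i)
    (akj : ¬ Adj k j) (aij : Adj i j)
    (hl : len (gen i * (gen k * p)) ≤ N) (h : gen i * (gen k * p) = gen j * q) :
    ∃ z, gen k * (gen i * p) = gen j * (gen i * z) ∧ gen k * q = gen i * (gen j * z) := by
  simp only [len_mul, len_gen] at hl
  obtain ⟨r, h1, rfl⟩ := H.adj aij (by simp; omega) h
  obtain ⟨s, rfl, h2⟩ := H.not_adj hkj akj (by omega) h1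
  simp only [len_mul, len_gen] at hl
  have hlr := congrArg len h2
  simp only [len_mul, len_gen] at hlr
  obtain ⟨t, rfl, rfl⟩ := H.adj aki.symm (by omega) h2
  have ajk := mt Adj.symm akj
  refine ⟨gen k * (gen i * (gen j * t)), ?_, ?_⟩
  · rw [gen_braid_mul aij, gen_comm_mul akj, gen_comm_mul ajk t, gen_braid_mul aki]
  · rw [gen_comm_mul ajk (gen i * t), gen_braid_mul aki, gen_braid_mul aij t, gen_comm_mul akj]

theorem linked_of_chain_mid (H : LcmUpTo m N) (hij : i ≠ j) (aik : Adj i k)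
    (akj : Adj k j) (aij : ¬ Adj i j)
    (hl : len (gen i * (gen k * p)) ≤ N)
    (h : gen i * (gen k * p) = gen j * (gen k * q)) :
    ∃ z, gen k * (gen i * p) = gen j * z ∧ gen k * (gen j * q) = gen i * z := by
  have hlq := congrArg len h
  simp only [len_mul, len_gen] at hl hlq
  obtain ⟨r, h1, h2⟩ := H.not_adj hij aij (by simp; omega) h
  obtain ⟨s, rfl, rfl⟩ := H.adj akj (by omega) h1
  obtain ⟨t, rfl, h3⟩ := H.adj aik.symm (by omega) h2
  have h4 := H.cancel (by simp at hl ⊢; omega) h3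
  obtain ⟨v, rfl, rfl⟩ := H.not_adj hij.symm (mt Adj.symm aij) (by simp at hl ⊢; omega) h4
  have aji := mt Adj.symm aij
  refine ⟨gen k * (gen i * (gen j * (gen k * v))), ?_, ?_⟩
  · rw [gen_comm_mul aij, gen_braid_mul aik, gen_braid_mul akj, gen_comm_mul aji]
  · rw [gen_comm_mul aji, gen_braid_mul akj.symm, gen_braid_mul aik.symm]

theorem linked_of_adj_comm (H : LcmUpTo m N) (hkj : k ≠ j) (aik : Adj i k)
    (akj : ¬ Adj k j) (hij : i ≠ j) (aij : ¬ Adj i j)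
    (hl : len (gen i * (gen k * p)) ≤ N) (h : gen i * (gen k * p) = gen j * q) :
    ∃ z, gen k * (gen i * p) = gen j * z ∧ gen k * q = gen i * z := by
  simp only [len_mul, len_gen] at hl
  obtain ⟨r, h1, rfl⟩ := H.not_adj hij aij (by simp; omega) h
  obtain ⟨s, rfl, rfl⟩ := H.not_adj hkj akj (by omega) h1
  refine ⟨gen k * (gen i * s), ?_, ?_⟩
  · rw [gen_comm_mul aij, gen_comm_mul akj]
  · rw [gen_braid_mul aik]

theorem Linked.trans (H : LcmUpTo m N) {w : Mon m} (hl : len w ≤ N)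
    (h1 : Linked i x k w) (h2 : Linked k w j y) : Linked i x j y := by
  obtain ⟨p, rfl, rfl⟩ := h1
  obtain ⟨q, h, rfl⟩ := h2
  by_cases hik : i = k
  · subst hik
    rw [compl_self, one_mul] at h
    exact ⟨q, by rw [compl_self, one_mul, h], rfl⟩
  by_cases hkj : k = j
  · subst hkj
    rw [compl_self, one_mul] at h
    exact ⟨p, rfl, by rw [compl_self, one_mul, h]⟩
  by_cases hij : i = j
  · subst hij
    have hpq : p = q := by
      by_cases aki : Adj k i
      · rw [compl_adj aki, len_mul, len_mul, len_gen, len_gen] at hl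
        rw [compl_adj aki, mul_assoc, mul_assoc] at h
        have h' := H.cancel (by rw [len_mul, len_gen]; omega) h
        exact H.cancel (by omega) h'
      · rw [compl_not_adj (Ne.symm hik) aki, len_mul, len_gen] at hl
        rw [compl_not_adj (Ne.symm hik) aki] at h
        exact H.cancel (by omega) h
    rw [hpq]
    exact Linked.refl _ _
  have hki := Ne.symm hik
  have hjk := Ne.symm hkj
  by_cases aik : Adj i k <;> by_cases akj : Adj k j <;> by_cases aij : Adj i j
  · unfold Adj at aik akj aij
    omega
  · rw [compl_adj aik.symm, compl_adj akj, mul_assoc, mul_assoc] at h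
    rw [compl_adj aik.symm, mul_assoc] at hl
    simpa only [Linked, compl_adj aik, compl_adj akj.symm, compl_not_adj hij aij,
      compl_not_adj (Ne.symm hij) (mt Adj.symm aij), mul_assoc] using
      linked_of_chain_mid H hij aik akj aij hl h
  · rw [compl_adj aik.symm, compl_not_adj hkj akj, mul_assoc] at h
    rw [compl_adj aik.symm, mul_assoc] at hl
    simpa only [Linked, compl_adj aik, compl_not_adj hjk (mt Adj.symm akj), compl_adj aij,
      compl_adj aij.symm, mul_assoc] using
      linked_of_chain_left H hkj aik.symm akj aij hl h
  · rw [compl_adj aik.symm, compl_not_adj hkj akj, mul_assoc] at h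
    rw [compl_adj aik.symm, mul_assoc] at hl
    simpa only [Linked, compl_adj aik, compl_not_adj hjk (mt Adj.symm akj),
      compl_not_adj hij aij, compl_not_adj (Ne.symm hij) (mt Adj.symm aij), mul_assoc] using
      linked_of_adj_comm H hkj aik akj hij aij hl h
  · have aki := mt Adj.symm aik
    rw [h, compl_adj akj, mul_assoc] at hl
    rw [compl_adj akj, compl_not_adj hki aki, mul_assoc] at h
    apply Linked.symm
    simpa only [Linked, compl_adj akj.symm, compl_not_adj hik aik, compl_adj aij,
      compl_adj aij.symm, mul_assoc] using
      linked_of_chain_left H hki akj aki aij.symm hl h.symm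
  · have aki := mt Adj.symm aik
    have aji := mt Adj.symm aij
    rw [h, compl_adj akj, mul_assoc] at hl
    rw [compl_adj akj, compl_not_adj hki aki, mul_assoc] at h
    apply Linked.symm
    simpa only [Linked, compl_adj akj.symm, compl_not_adj hik aik, compl_not_adj hij aij,
      compl_not_adj (Ne.symm hij) aji, mul_assoc] using
      linked_of_adj_comm H hki akj.symm aki (Ne.symm hij) aji hl h.symm
  · have aki := mt Adj.symm aik
    rw [compl_not_adj hki aki] at h hl
    rw [compl_not_adj hkj akj] at h
    rw [len_mul, len_gen] at hl
    obtain ⟨r, rfl, rfl⟩ := H.adj aij (by omega) h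
    refine ⟨gen k * r, ?_, ?_⟩
    · rw [compl_not_adj hik aik, compl_adj aij, mul_assoc, gen_comm_mul akj, gen_comm_mul aki]
    · rw [compl_not_adj hjk (mt Adj.symm akj), compl_adj aij.symm, mul_assoc,
        gen_comm_mul aki, gen_comm_mul akj]
  · have aki := mt Adj.symm aik
    rw [compl_not_adj hki aki] at h hl
    rw [compl_not_adj hkj akj] at h
    rw [len_mul, len_gen] at hl
    obtain ⟨r, rfl, rfl⟩ := H.not_adj hij aij (by omega) h
    refine ⟨gen k * r, ?_, ?_⟩
    · rw [compl_not_adj hik aik, compl_not_adj hij aij, gen_comm_mul akj]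
    · rw [compl_not_adj hjk (mt Adj.symm akj), compl_not_adj (Ne.symm hij) (mt Adj.symm aij),
        gen_comm_mul aki]

end Cube

theorem Linked.mul_right {i j : Fin m} {x y : Mon m} (h : Linked i x j y) (t : Mon m) :
    Linked i (x * t) j (y * t) := by
  obtain ⟨z, rfl, rfl⟩ := h
  exact ⟨z * t, by rw [mul_assoc], by rw [mul_assoc]⟩

theorem coe_of_mul (i : Fin m) (u : FreeMonoid (Fin m)) :
    ((FreeMonoid.of i * u : FreeMonoid (Fin m)) : Mon m) = gen i * (u : Mon m) := rfl

theorem coe_eq_of_rel {u v : FreeMonoid (Fin m)} (h : ConGen.Rel (BraidRel m) u v) :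
    (u : Mon m) = (v : Mon m) :=
  (Con.eq _).2 h

theorem linked_of_rel {N : ℕ} (H : LcmUpTo m N) {u v : FreeMonoid (Fin m)}
    (h : ConGen.Rel (BraidRel m) u v) :
    ∀ (i j : Fin m) (u' v' : FreeMonoid (Fin m)), u = FreeMonoid.of i * u' →
      v = FreeMonoid.of j * v' → len (u' : Mon m) ≤ N →
      Linked i (u' : Mon m) j (v' : Mon m) := by
  induction h with
  | of u v h =>
    rintro i j u' v' rfl rfl -
    rcases h with ⟨a, b, hab, h1, h2⟩ | ⟨a, b, hab, h1, h2⟩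
    · obtain ⟨rfl, rfl⟩ := List.cons.inj h1
      obtain ⟨rfl, rfl⟩ := List.cons.inj h2
      have hne : i ≠ j := by rintro rfl; omega
      have ha : ¬ Adj i j := by unfold Adj; omega
      refine ⟨1, ?_, ?_⟩
      · rw [compl_not_adj hne ha, mul_one]; rfl
      · rw [compl_not_adj hne.symm (mt Adj.symm ha), mul_one]; rfl
    · obtain ⟨rfl, rfl⟩ := List.cons.inj h1
      obtain ⟨rfl, rfl⟩ := List.cons.inj h2
      have ha : Adj i j := Or.inl hab
      refine ⟨1, ?_, ?_⟩
      · rw [compl_adj ha, mul_one]; rfl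
      · rw [compl_adj ha.symm, mul_one]; rfl
  | refl u =>
    rintro i j u' v' rfl h -
    obtain ⟨rfl, rfl⟩ := List.cons.inj h
    exact Linked.refl _ _
  | symm h ih =>
    rintro i j u' v' rfl rfl hl
    have := congrArg len (coe_eq_of_rel h)
    simp only [coe_of_mul, len_mul, len_gen] at this
    exact (ih j i v' u' rfl rfl (by omega)).symm
  | @trans _ w _ h1 h2 ih1 ih2 =>
    rintro i j u' v' rfl rfl hl
    have hlen := congrArg len (coe_eq_of_rel h1)
    cases w using FreeMonoid.casesOn with
    | one =>
          simp only [coe_of_mul, len_mul, len_gen, Con.coe_one, len_one] at hlen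
          omega
    | of_mul k w' =>
      simp only [coe_of_mul, len_mul, len_gen] at hlen
      exact Linked.trans H (by omega) (ih1 i k u' w' rfl rfl hl)
        (ih2 k j w' v' rfl rfl (by omega))
  | @mul w x y z h1 h2 ih1 ih2 =>
    intro i j u' v' hu hv hl
    have hlen := congrArg len (coe_eq_of_rel h1)
    cases w using FreeMonoid.casesOn with
    | one =>
      cases x using FreeMonoid.casesOn with
      | one => exact ih2 i j u' v' (by rwa [one_mul] at hu) (by rwa [one_mul] at hv) hl
      | of_mul k x' =>
          simp only [coe_of_mul, len_mul, len_gen, Con.coe_one, len_one] at hlen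
          omega
    | of_mul k w' =>
      cases x using FreeMonoid.casesOn with
      | one =>
          simp only [coe_of_mul, len_mul, len_gen, Con.coe_one, len_one] at hlen
          omega
      | of_mul l x' =>
        obtain ⟨rfl, rfl⟩ := List.cons.inj hu
        obtain ⟨rfl, rfl⟩ := List.cons.inj hv
        change len ((w' : Mon m) * (y : Mon m)) ≤ N at hl
        rw [len_mul] at hl
        have := (ih1 k l w' x' rfl rfl (by omega)).mul_right (y : Mon m)
        change Linked k ((w' : Mon m) * (y : Mon m)) l ((x' : Mon m) * (z : Mon m))
        rwa [← coe_eq_of_rel h2]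

theorem lcmUpTo (m N : ℕ) : LcmUpTo m N := by
  induction N with
  | zero => intro i j x y h; omega
  | succ N ih =>
    intro i j x y hl h
    induction x using Con.induction_on with
    | H u =>
      induction y using Con.induction_on with
      | H v => exact linked_of_rel ih ((Con.eq _).1 h) i j u v rfl rfl (by omega)

/-- Two generators admit a least common right multiple. -/
theorem linked_of_gen_mul_eq {i j : Fin m} {x y : Mon m} (h : gen i * x = gen j * y) :
    Linked i x j y :=
  lcmUpTo m (len x + 1) i j x y (by omega) h

theorem gen_mul_left_cancel {i : Fin m} {x y : Mon m} (h : gen i * x = gen i * y) : x = y :=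
  (lcmUpTo m (len x + 1)).cancel (by omega) h

theorem mul_left_cancel' {a x y : Mon m} (h : a * x = a * y) : x = y := by
  induction hn : len a generalizing a with
  | zero =>
    rw [len_eq_zero.1 hn] at h
    simpa using h
  | succ n ih =>
    rcases mon_cases a with rfl | ⟨i, b, rfl⟩
    · simp at hn
    · rw [mul_assoc, mul_assoc] at h
      exact ih (gen_mul_left_cancel h) (by rw [len_mul, len_gen] at hn; omega)

theorem one_ldvd (x : Mon m) : LDvd 1 x := ⟨x, one_mul x⟩

theorem ldvd_mul (x y : Mon m) : LDvd x (x * y) := ⟨y, rfl⟩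

theorem ldvd_trans {x y z : Mon m} (h1 : LDvd x y) (h2 : LDvd y z) : LDvd x z := by
  obtain ⟨a, rfl⟩ := h1
  obtain ⟨b, rfl⟩ := h2
  exact ⟨a * b, by rw [mul_assoc]⟩

theorem len_le_of_ldvd {x y : Mon m} (h : LDvd x y) : len x ≤ len y := by
  obtain ⟨a, rfl⟩ := h
  simp

theorem eq_of_ldvd_of_len_le {x y : Mon m} (h : LDvd x y) (hl : len y ≤ len x) : x = y := by
  obtain ⟨a, rfl⟩ := h
  rw [len_mul] at hl
  rw [len_eq_zero.1 (show len a = 0 by omega), mul_one]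

theorem mul_ldvd_mul_left_iff {a x y : Mon m} : LDvd (a * x) (a * y) ↔ LDvd x y := by
  constructor
  · rintro ⟨c, hc⟩
    exact ⟨c, mul_left_cancel' (by rw [← mul_assoc, hc])⟩
  · rintro ⟨c, rfl⟩
    exact ⟨c, mul_assoc _ _ _⟩

theorem compl_ldvd {i j : Fin m} {x : Mon m} (h : LDvd (gen j) (gen i * x)) :
    LDvd (compl i j) x := by
  obtain ⟨c, hc⟩ := h
  obtain ⟨z, rfl, -⟩ := linked_of_gen_mul_eq hc.symm
  exact ⟨z, rfl⟩

/-- `d` is a greatest common left divisor of `g` and `h`. -/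
def IsLeftGcd (d g h : Mon m) : Prop :=
  LDvd d g ∧ LDvd d h ∧ ∀ e, LDvd e g → LDvd e h → LDvd e d

/-- If `d` is a left gcd of `g` and `h` then a generator dividing both `gen i * g` and
`gen i * h` divides `gen i * d`. -/
theorem IsLeftGcd.gen_ldvd {d g h : Mon m} (H : IsLeftGcd d g h) {i j : Fin m}
    (hg : LDvd (gen j) (gen i * g)) (hh : LDvd (gen j) (gen i * h)) :
    LDvd (gen j) (gen i * d) := by
  have h1 := H.2.2 _ (compl_ldvd hg) (compl_ldvd hh)
  refine ldvd_trans ⟨compl j i, ?_⟩ (mul_ldvd_mul_left_iff.2 h1)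
  rw [gen_mul_compl]

theorem exists_isLeftGcd (g h : Mon m) : ∃ d, IsLeftGcd d g h := by
  induction hn : len g using Nat.strong_induction_on generalizing g h with
  | _ n ih =>
    by_cases hc : ∃ i : Fin m, LDvd (gen i) g ∧ LDvd (gen i) h
    · obtain ⟨i, ⟨g, rfl⟩, ⟨h, rfl⟩⟩ := hc
      rw [len_mul, len_gen] at hn
      obtain ⟨d, hd⟩ := ih (len g) (by omega) g h rfl
      refine ⟨gen i * d, mul_ldvd_mul_left_iff.2 hd.1, mul_ldvd_mul_left_iff.2 hd.2.1, ?_⟩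
      intro e heg heh
      rcases mon_cases e with rfl | ⟨j, e, rfl⟩
      · exact one_ldvd _
      have hjg := ldvd_trans (ldvd_mul _ _) heg
      have hjh := ldvd_trans (ldvd_mul _ _) heh
      obtain ⟨d₂, hd₂⟩ := hd.gen_ldvd hjg hjh
      obtain ⟨g₁, hg₁⟩ := hjg
      obtain ⟨h₁, hh₁⟩ := hjh
      have hlg := congrArg len hg₁
      rw [len_mul, len_mul, len_gen, len_gen] at hlg
      obtain ⟨d₁, hd₁⟩ := ih (len g₁) (by omega) g₁ h₁ rfl
      rw [← hg₁, mul_ldvd_mul_left_iff] at heg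
      rw [← hh₁, mul_ldvd_mul_left_iff] at heh
      have h21 : LDvd d₂ d₁ := by
        apply hd₁.2.2
        · rw [← mul_ldvd_mul_left_iff (a := gen j), hg₁, hd₂, mul_ldvd_mul_left_iff]
          exact hd.1
        · rw [← mul_ldvd_mul_left_iff (a := gen j), hh₁, hd₂, mul_ldvd_mul_left_iff]
          exact hd.2.1
      obtain ⟨d₃, hd₃⟩ := hd₁.gen_ldvd (i := j) (j := i) ⟨g, hg₁.symm⟩ ⟨h, hh₁.symm⟩
      have h3 : LDvd d₃ d := by
        apply hd.2.2
        · rw [← mul_ldvd_mul_left_iff (a := gen i), ← hg₁, hd₃, mul_ldvd_mul_left_iff]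
          exact hd₁.1
        · rw [← mul_ldvd_mul_left_iff (a := gen i), ← hh₁, hd₃, mul_ldvd_mul_left_iff]
          exact hd₁.2.1
      have hl := len_le_of_ldvd h3
      have e1 := congrArg len hd₂
      have e2 := congrArg len hd₃
      simp only [len_mul, len_gen] at e1 e2
      rw [← hd₂, eq_of_ldvd_of_len_le h21 (by omega), mul_ldvd_mul_left_iff]
      exact hd₁.2.2 _ heg heh
    · refine ⟨1, one_ldvd _, one_ldvd _, fun e heg heh => ?_⟩
      rcases mon_cases e with rfl | ⟨j, e, rfl⟩
      · exact one_ldvd _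
      · exact absurd ⟨j, ldvd_trans (ldvd_mul _ _) heg, ldvd_trans (ldvd_mul _ _) heh⟩ hc

section Delta

variable {n : ℕ}

theorem braidSigma_eq_gen (i : Fin (n - 1)) : braidSigma n i = gen i := by
  simp [braidSigma, gen]

theorem braidSigma_comm {i j : ℕ} (h : i + 2 ≤ j) :
    braidSigma n i * braidSigma n j = braidSigma n j * braidSigma n i := by
  by_cases hj : j < n - 1
  · have := gen_comm (i := (⟨i, by omega⟩ : Fin (n - 1))) (j := ⟨j, hj⟩)
      (by simp only [Adj]; omega)
    simpa only [← braidSigma_eq_gen] using this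
  · simp [braidSigma, hj]

theorem braidSigma_braid {i : ℕ} (h : i + 1 < n - 1) :
    braidSigma n i * braidSigma n (i + 1) * braidSigma n i =
      braidSigma n (i + 1) * braidSigma n i * braidSigma n (i + 1) := by
  have := gen_braid (i := (⟨i, by omega⟩ : Fin (n - 1))) (j := ⟨i + 1, h⟩) (Or.inl rfl)
  simpa only [← braidSigma_eq_gen] using this

/-- The product `σ_k ⋯ σ_1`. -/
def descProd (n k : ℕ) : PosBraid n := (((List.range k).reverse).map (braidSigma n)).prod

theorem descProd_succ (k : ℕ) : descProd n (k + 1) = braidSigma n k * descProd n k := by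
  simp [descProd, List.range_succ]

theorem braidDelta_succ (k : ℕ) : braidDelta n (k + 1) = braidDelta n k * descProd n k := rfl

theorem descProd_comm {k j : ℕ} (h : k + 1 ≤ j) :
    descProd n k * braidSigma n j = braidSigma n j * descProd n k := by
  induction k with
  | zero => simp [descProd]
  | succ k ih =>
    rw [descProd_succ, mul_assoc, ih (by omega), ← mul_assoc, braidSigma_comm (by omega),
      mul_assoc]

theorem braidDelta_comm {k j : ℕ} (h : k ≤ j) :
    braidDelta n k * braidSigma n j = braidSigma n j * braidDelta n k := by
  induction k with
  | zero => simp [braidDelta]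
  | succ k ih =>
    rw [braidDelta_succ, mul_assoc, descProd_comm h, ← mul_assoc, ih (by omega), mul_assoc]

theorem braidSigma_mul_descProd {i k : ℕ} (hi : i + 1 < k) (hk : k ≤ n - 1) :
    braidSigma n i * descProd n k = descProd n k * braidSigma n (i + 1) := by
  induction k with
  | zero => omega
  | succ k ih =>
    by_cases hik : i + 1 < k
    · rw [descProd_succ, ← mul_assoc, braidSigma_comm (by omega), mul_assoc,
        ih hik (by omega), mul_assoc]
    · obtain rfl : k = i + 1 := by omega
      rw [descProd_succ, descProd_succ, ← mul_assoc, ← mul_assoc, braidSigma_braid (by omega),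
        mul_assoc _ (braidSigma n (i + 1)), ← descProd_comm le_rfl]
      simp only [mul_assoc]

theorem descProd_ldvd_descProd_mul {l k : ℕ} (hl : l < k) (hk : k ≤ n - 1) :
    LDvd (descProd n k) (descProd n l * descProd n k) := by
  induction l with
  | zero => exact ⟨1, by simp [descProd]⟩
  | succ l ih =>
    obtain ⟨c, hc⟩ := ih (by omega)
    rw [descProd_succ, mul_assoc, ← hc, ← mul_assoc, braidSigma_mul_descProd hl hk, mul_assoc]
    exact ldvd_mul _ _

theorem braidSigma_ldvd_braidDelta {j k : ℕ} (hj : j + 1 < k) (hk : k ≤ n) :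
    LDvd (braidSigma n j) (braidDelta n k) := by
  induction k with
  | zero => omega
  | succ k ih =>
    by_cases hjk : j + 1 < k
    · exact ldvd_trans (ih hjk (by omega)) (ldvd_mul _ _)
    · obtain rfl : k = j + 1 := by omega
      obtain ⟨c, hc⟩ := descProd_ldvd_descProd_mul (n := n) (Nat.lt_succ_self j) (by omega)
      rw [braidDelta_succ, braidDelta_succ, mul_assoc, ← hc, descProd_succ, mul_assoc,
        ← mul_assoc, braidDelta_comm le_rfl, mul_assoc]
      exact ldvd_mul _ _

theorem gen_ldvd_braidDelta (i : Fin (n - 1)) : LDvd (gen i) (braidDelta n n) := by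
  rw [← braidSigma_eq_gen]
  exact braidSigma_ldvd_braidDelta (by omega) le_rfl

end Delta

section Greedy

variable {D : Mon m}

/-- The greedy condition on a list of divisors of `D`. -/
def IsGreedy (D : Mon m) (L : List (Mon m)) : Prop :=
  (∀ s ∈ L, LDvd s D) ∧ L.getLast? ≠ some 1 ∧
    ∀ i : ℕ, i + 1 < L.length → ∀ s : Mon m, LDvd s D →
      LDvd (L.getD i 1) s → L.getD i 1 ≠ s → ¬ LDvd s ((L.drop i).prod)

theorem IsLeftGcd.unique {d d' g h : Mon m} (H : IsLeftGcd d g h) (H' : IsLeftGcd d' g h) :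
    d = d' :=
  eq_of_ldvd_of_len_le (H'.2.2 _ H.1 H.2.1) (len_le_of_ldvd (H.2.2 _ H'.1 H'.2.1))

theorem len_le_len_prod {s : Mon m} {L : List (Mon m)} (h : s ∈ L) : len s ≤ len L.prod := by
  induction L with
  | nil => simp at h
  | cons t L ih =>
    rw [List.prod_cons, len_mul]
    rcases List.mem_cons.1 h with rfl | h
    · omega
    · have := ih h
      omega

theorem IsGreedy.eq_nil {L : List (Mon m)} (H : IsGreedy D L) (h : L.prod = 1) : L = [] := by
  by_contra hne
  apply H.2.1
  rw [List.getLast?_eq_getLast_of_ne_nil hne, Option.some_inj, ← len_eq_zero]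
  have := len_le_len_prod (List.getLast_mem hne)
  rw [h, len_one] at this
  omega

theorem IsGreedy.tail {s : Mon m} {L : List (Mon m)} (H : IsGreedy D (s :: L)) :
    IsGreedy D L := by
  refine ⟨fun t ht => H.1 t (List.mem_cons_of_mem _ ht), ?_, fun i hi => ?_⟩
  · cases L with
    | nil => simp
    | cons t L => simpa [List.getLast?_cons_cons] using H.2.1
  · simpa using H.2.2 (i + 1) (by simpa using hi)

theorem IsGreedy.isLeftGcd {s : Mon m} {L : List (Mon m)} (H : IsGreedy D (s :: L)) :
    IsLeftGcd s D (s :: L).prod := by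
  obtain ⟨d, hd⟩ := exists_isLeftGcd D (s :: L).prod
  have hsD : LDvd s D := H.1 s List.mem_cons_self
  have hs : LDvd s (s :: L).prod := ⟨L.prod, List.prod_cons.symm⟩
  have hsd := hd.2.2 s hsD hs
  suffices s = d by rwa [this] at hd ⊢
  cases L with
  | nil =>
    refine eq_of_ldvd_of_len_le hsd ?_
    simpa using len_le_of_ldvd hd.2.1
  | cons t L =>
    by_contra hne
    exact H.2.2 0 (by simp) d hd.1 hsd hne hd.2.1

theorem IsGreedy.cons {s : Mon m} {L : List (Mon m)} (H : IsGreedy D L) (hs : s ≠ 1)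
    (hg : IsLeftGcd s D (s * L.prod)) : IsGreedy D (s :: L) := by
  refine ⟨?_, ?_, ?_⟩
  · rintro t ht
    rcases List.mem_cons.1 ht with rfl | ht
    · exact hg.1
    · exact H.1 t ht
  · cases L with
    | nil => simpa using hs
    | cons t L => simpa [List.getLast?_cons_cons] using H.2.1
  · rintro (_ | i) hi t htD hst hne htg
    · rw [List.drop_zero, List.prod_cons] at htg
      exact hne (eq_of_ldvd_of_len_le hst (len_le_of_ldvd (hg.2.2 t htD htg)))
    · exact H.2.2 i (by simpa using hi) t htD hst hne htg

theorem IsGreedy.unique {L L' : List (Mon m)} (H : IsGreedy D L) (H' : IsGreedy D L')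
    (h : L.prod = L'.prod) : L = L' := by
  induction L generalizing L' with
  | nil => exact (H'.eq_nil h.symm).symm
  | cons s L ih =>
    cases L' with
    | nil => exact H.eq_nil h
    | cons s' L' =>
      have hg := H.isLeftGcd
      rw [h] at hg
      obtain rfl := hg.unique H'.isLeftGcd
      rw [List.prod_cons, List.prod_cons] at h
      rw [ih H.tail H'.tail (mul_left_cancel' h)]

theorem exists_isGreedy (hD : ∀ i : Fin m, LDvd (gen i) D) (g : Mon m) :
    ∃ L, IsGreedy D L ∧ L.prod = g := by
  induction hn : len g using Nat.strong_induction_on generalizing g with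
  | _ n ih =>
    rcases mon_cases g with rfl | ⟨i, y, hy⟩
    · exact ⟨[], ⟨by simp, by simp, by simp⟩, rfl⟩
    obtain ⟨s, hs⟩ := exists_isLeftGcd D g
    have hpos := len_le_of_ldvd (hs.2.2 _ (hD i) ⟨y, hy.symm⟩)
    rw [len_gen] at hpos
    obtain ⟨c, hc⟩ := hs.2.1
    have hlen := congrArg len hc
    rw [len_mul] at hlen
    obtain ⟨L, hL, rfl⟩ := ih (len c) (by omega) c rfl
    refine ⟨s :: L, hL.cons ?_ (by rwa [hc]), by rw [List.prod_cons, hc]⟩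
    rintro rfl
    simp at hpos

end Greedy

end PosBraid

/-- Every element `g` of `B_n^+` admits a unique decomposition
`s_1|…|s_p` where each `s_i` left-divides `Δ_n`, `s_p ≠ 1`, and for every `i < p` and
every left-divisor `s` of `Δ_n`, `s_i ≺ s` implies that `s` does not left-divide
`s_i s_{i+1} ⋯ s_p`. -/
theorem posBraid_greedy_normal_form (n : ℕ) (g : PosBraid n) :
    ∃! L : List (PosBraid n),
      (∀ s ∈ L, LDvd s (braidDelta n n)) ∧
      L.getLast? ≠ some 1 ∧
      L.prod = g ∧
      (∀ i : ℕ, i + 1 < L.length → ∀ s : PosBraid n, LDvd s (braidDelta n n) →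
        LDvd (L.getD i 1) s → L.getD i 1 ≠ s → ¬ LDvd s ((L.drop i).prod)) := by
  obtain ⟨L, hL, rfl⟩ := PosBraid.exists_isGreedy PosBraid.gen_ldvd_braidDelta g
  refine ⟨L, ⟨hL.1, hL.2.1, rfl, hL.2.2⟩, ?_⟩
  rintro L' ⟨h1, h2, h3, h4⟩
  exact PosBraid.IsGreedy.unique ⟨h1, h2, h4⟩ hL h3
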